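/- If Γ is a connected strongly regular graph with parameters (28, 9, 0, 4), then the rank of its Laplacian matrix L over the field with 7 elements is 22; equivalently, the kernel of L mod 7 has dimension 6. -/

import Mathlib

open SimpleGraph

/-- If a symmetric integer matrix satisfies `W * W = c • W`, so that `c • W` is a Gram
matrix, then the sum of the cubes of the entries of `c • W` is nonnegative. -/
theorem Matrix.sum_smul_pow_three_nonneg {V : Type*} [Fintype V] (W : Matrix V V ℤ) (c : ℤ)
    (hsymm : W.IsSymm) (hW : W * W = c • W) :
    0 ≤ ∑ i, ∑ j, (c * W i j) ^ 3 := by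
  have entry (i j : V) : c * W i j = ∑ a, W a i * W a j := by
    rw [← smul_eq_mul, ← Matrix.smul_apply, ← hW, Matrix.mul_apply]
    exact Finset.sum_congr rfl fun a _ => by rw [hsymm.apply a i]
  have cube (i j : V) : (c * W i j) ^ 3 =
      ∑ a, ∑ b, ∑ d, (W a i * W b i * W d i) * (W a j * W b j * W d j) := by
    rw [entry, pow_three, Finset.sum_mul_sum, Finset.sum_mul_sum]
    refine Finset.sum_congr rfl fun a _ => ?_
    simp_rw [Finset.mul_sum]
    exact Finset.sum_congr rfl fun b _ => Finset.sum_congr rfl fun d _ => by ring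
  have key : ∑ i, ∑ j, (c * W i j) ^ 3 =
      ∑ a, ∑ b, ∑ d, (∑ i, W a i * W b i * W d i) ^ 2 := by
    simp_rw [cube, sq, Finset.sum_mul_sum]
    calc _ = ∑ i, ∑ a, ∑ b, ∑ d, ∑ j, (W a i * W b i * W d i) * (W a j * W b j * W d j) := by
          refine Finset.sum_congr rfl fun i _ => ?_
          rw [Finset.sum_comm]
          refine Finset.sum_congr rfl fun a _ => ?_
          rw [Finset.sum_comm]
          exact Finset.sum_congr rfl fun b _ => Finset.sum_comm
      _ = _ := by
          rw [Finset.sum_comm]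
          refine Finset.sum_congr rfl fun a _ => ?_
          rw [Finset.sum_comm]
          exact Finset.sum_congr rfl fun b _ => Finset.sum_comm
  rw [key]
  positivity

/-- There is no strongly regular graph with parameters `(28, 9, 0, 4)`: these parameters violate
the Krein condition. -/
theorem SimpleGraph.not_isSRGWith_28_9_0_4 {V : Type*} [Fintype V] [DecidableEq V]
    (G : SimpleGraph V) [DecidableRel G.Adj] : ¬ G.IsSRGWith 28 9 0 4 := by
  intro h
  set A := G.adjMatrix ℤ with hA
  let J : Matrix V V ℤ := Matrix.of fun _ _ => 1
  have row (i : V) : ∑ j, A i j = 9 := by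
    have hdeg := h.regular.degree_eq i
    rw [← G.card_neighborFinset_eq_degree, G.neighborFinset_eq_filter] at hdeg
    simp [hA, SimpleGraph.adjMatrix_apply, hdeg]
  have col (j : V) : ∑ i, A i j = 9 := by
    simp_rw [← row j, hA, SimpleGraph.adjMatrix_apply, G.adj_comm]
  have hAJ : A * J = (9 : ℤ) • J := by
    ext i j
    simp [Matrix.mul_apply, J, row]
  have hJA : J * A = (9 : ℤ) • J := by
    ext i j
    simp [Matrix.mul_apply, J, col]
  have hJJ : J * J = (28 : ℤ) • J := by
    ext i j
    simp [Matrix.mul_apply, J, h.card]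
  have hAA : A * A = (5 : ℤ) • (1 : Matrix V V ℤ) - (4 : ℤ) • A + (4 : ℤ) • J := by
    have hcompl : Gᶜ.adjMatrix ℤ = J - 1 - A := by
      ext i j
      rw [Matrix.sub_apply, Matrix.sub_apply]
      by_cases hij : i = j
      · subst hij
        simp [J, hA]
      · by_cases hadj : G.Adj i j <;> simp [J, hA, hij, hadj]
    rw [← sq, hA, h.matrix_eq, hcompl]
    module
  let W : Matrix V V ℤ := (7 : ℤ) • (1 : Matrix V V ℤ) - (7 : ℤ) • A + (2 : ℤ) • J
  have entry (i j : V) : W i j =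
      7 * (if i = j then 1 else 0) - 7 * (if G.Adj i j then 1 else 0) + 2 := by
    simp only [W, J, hA, Matrix.add_apply, Matrix.sub_apply, Matrix.smul_apply, Matrix.one_apply,
      SimpleGraph.adjMatrix_apply, Matrix.of_apply, smul_eq_mul, mul_one]
  have hsymm : W.IsSymm := by
    ext i j
    rw [Matrix.transpose_apply, entry, entry]
    simp only [G.adj_comm j i, eq_comm (a := j)]
  have hW : W * W = (42 : ℤ) • W := by
    simp only [W, add_mul, sub_mul, mul_add, mul_sub, smul_mul_assoc, mul_smul_comm, one_mul,
      mul_one, hAA, hAJ, hJA, hJJ]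
    module
  have cube (i j : V) : (42 * W i j) ^ 3 =
      42 ^ 3 * (8 + 721 * (if i = j then 1 else 0) - 133 * A i j) := by
    by_cases hij : i = j
    · subst hij
      simp [entry, hA]
    · by_cases hadj : G.Adj i j <;> simp [entry, hA, hij, hadj]
  have nonneg := Matrix.sum_smul_pow_three_nonneg W 42 hsymm hW
  simp_rw [cube, ← Finset.mul_sum, Finset.sum_sub_distrib, Finset.sum_add_distrib,
    ← Finset.mul_sum, row] at nonneg
  simp [h.card] at nonneg

/-- If `Γ` is a connected strongly regular graph with parameters
`(28, 9, 0, 4)`, then the rank of its Laplacian matrix over `𝔽₇` is `22`; equivalently,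
the kernel of the Laplacian mod `7` has dimension `6`. -/
theorem srg_28_9_0_4_lapMatrix_rank_mod_seven {V : Type*} [Fintype V] [DecidableEq V]
    (G : SimpleGraph V) [DecidableRel G.Adj]
    (hsrg : G.IsSRGWith 28 9 0 4) (hconn : G.Connected) :
    (G.lapMatrix (ZMod 7)).rank = 22 ∧
    Module.finrank (ZMod 7)
      ↥(LinearMap.ker (Matrix.toLin' (G.lapMatrix (ZMod 7)))) = 6 := by
  exact absurd hsrg G.not_isSRGWith_28_9_0_4
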